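/- (Combinatorial core of Theorem 2.) Let S be a weighted system of m linear equations over F_2 in n variables such that: the supports α_1,…,α_m are pairwise distinct nonempty subsets of {1,…,n}, every variable i ∈ {1,…,n} occurs in at least one α_j, and the only z : {1,…,n} → F_2 with Σ_{i∈α_j} z_i = 0 for all j is z = 0 (i.e., the coefficient matrix has rank n). Let ρ = max_{1≤i≤n} |{j : i ∈ α_j}| be the maximum number of equations containing any one variable, and let k ≥ 1 be an integer. If m > 2ρ(k−1), then there exists an assignment z with 2·sat(z) ≥ W + k. -/

import Mathlib

/-- A vector outside a subspace of `F₂^ι` is detected by a vector orthogonal to that subspace. -/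
lemma exists_dotProduct_eq_one_of_notMem {ι : Type*} [Fintype ι]
    {U : Submodule (ZMod 2) (ι → ZMod 2)} {x : ι → ZMod 2} (hx : x ∉ U) :
    ∃ u : ι → ZMod 2, (∀ y ∈ U, y ⬝ᵥ u = 0) ∧ x ⬝ᵥ u = 1 := by
  classical
  obtain ⟨f, hfx, hf⟩ := Submodule.exists_le_ker_of_notMem hx
  have key : ∀ y, y ⬝ᵥ (fun i => f (Pi.single i 1)) = f y := by
    intro y
    rw [f.pi_apply_eq_sum_univ y]
    simp only [dotProduct, smul_eq_mul]
    refine Finset.sum_congr rfl fun i _ => ?_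
    congr 2
    ext j
    simp [Pi.single_apply, eq_comm]
  refine ⟨fun i => f (Pi.single i 1), fun y hy => ?_, ?_⟩
  · rw [key]
    exact hf hy
  · rw [key]
    exact Fin.eq_one_of_ne_zero _ hfx

open Finset in
/-- If restriction to the coordinates in `I` is injective on `U`, and fewer than half of the
vectors `v j` meet `I`, then some `v j` is alone in its coset of `U` and lies outside `U`. -/
lemma exists_isolated_coset {ι κ : Type*} [Fintype κ]
    {v : κ → ι → ZMod 2} (hv : Function.Injective v) (hv0 : ∀ j, v j ≠ 0)
    (U : Submodule (ZMod 2) (ι → ZMod 2)) (I : Finset ι)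
    (hI : ∀ u ∈ U, (∀ i ∈ I, u i = 0) → u = 0) (B : Finset κ)
    (hB : ∀ j ∉ B, ∀ i ∈ I, v j i = 0) (hcard : 2 * #B < Fintype.card κ) :
    ∃ j, v j ∉ U ∧ ∀ l, v l - v j ∈ U → l = j := by
  classical
  by_contra! h
  have hpartner : ∀ j ∉ B, ∃ l, v l - v j ∈ U ∧ l ≠ j :=
    fun j hj => h j fun hjU => hv0 j (hI _ hjU (hB j hj))
  have huniq : ∀ j ∉ B, ∀ l ∉ B, v l - v j ∈ U → l = j := fun j hj l hl hU =>
    hv (sub_eq_zero.mp (hI _ hU fun i hi => by simp [hB j hj i hi, hB l hl i hi]))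
  choose! p hpU hpne using hpartner
  have hle : #Bᶜ ≤ #B := by
    refine card_le_card_of_injOn p (fun j hj => ?_) fun j hj l hl hjl => ?_
    · have hj : j ∉ B := by simpa using hj
      by_contra hpB
      exact hpne j hj (huniq j hj _ hpB (hpU j hj))
    · have hj : j ∉ B := by simpa using hj
      have hl : l ∉ B := by simpa using hl
      refine huniq l hl j hj ?_
      have := U.sub_mem (hpU l hl) (hpU j hj)
      rw [hjl] at this
      simpa using this
  have := card_add_card_compl B
  omega

open Finset in
/-- If every coordinate is nonzero in at most `ρ` of the distinct nonzero vectors `v j`, and there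
are more than `2ρ(k-1)` of them, then some `k` of them admit a common solution of their equations
and are exactly the vectors `v j` in some subspace. -/
lemma exists_subspace_inter_eq {ι κ : Type*} [Fintype ι] [Fintype κ]
    {v : κ → ι → ZMod 2} (hv : Function.Injective v) (hv0 : ∀ j, v j ≠ 0) (b : κ → ZMod 2)
    (ρ k : ℕ) (hρ : ∀ i, #{j | v j i ≠ 0} ≤ ρ)
    (hm : 2 * ρ * (k - 1) < Fintype.card κ) :
    ∃ (U : Submodule (ZMod 2) (ι → ZMod 2)) (J : Finset κ) (z : ι → ZMod 2),
      #J = k ∧ (∀ j, v j ∈ U ↔ j ∈ J) ∧ ∀ j ∈ J, v j ⬝ᵥ z = b j := by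
  classical
  suffices h : ∀ t ≤ k, ∃ (U : Submodule (ZMod 2) (ι → ZMod 2)) (J : Finset κ)
      (z : ι → ZMod 2) (I : Finset ι), #J = t ∧ (∀ j, v j ∈ U ↔ j ∈ J) ∧
      (∀ j ∈ J, v j ⬝ᵥ z = b j) ∧ #I ≤ t ∧ ∀ u ∈ U, (∀ i ∈ I, u i = 0) → u = 0 by
    obtain ⟨U, J, z, -, h₁, h₂, h₃, -⟩ := h k le_rfl
    exact ⟨U, J, z, h₁, h₂, h₃⟩
  intro t
  induction t with
  | zero => exact fun _ => ⟨⊥, ∅, 0, ∅, by simp [hv0]⟩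
  | succ t ih =>
    intro ht
    obtain ⟨U, J, z, I, hJ, hUJ, hz, hIt, hI⟩ := ih (by omega)
    obtain ⟨j, hjU, hj⟩ : ∃ j, v j ∉ U ∧ ∀ l, v l - v j ∈ U → l = j := by
      refine exists_isolated_coset hv hv0 U I hI (I.biUnion fun i => {j | v j i ≠ 0}) ?_ ?_
      · simp only [mem_biUnion, mem_filter, mem_univ, true_and]
        intro j hj i hi
        by_contra hne
        exact hj ⟨i, hi, hne⟩
      · calc 2 * #(I.biUnion fun i => {j | v j i ≠ 0}) ≤ 2 * (#I * ρ) := by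
              gcongr
              exact card_biUnion_le_card_mul _ _ _ fun i _ => hρ i
          _ ≤ 2 * ((k - 1) * ρ) := by
              gcongr
              omega
          _ = 2 * ρ * (k - 1) := by ring
          _ < Fintype.card κ := hm
    have hjJ : j ∉ J := fun h => hjU ((hUJ j).2 h)
    have hmem : ∀ x, x ∈ U ⊔ Submodule.span (ZMod 2) {v j} ↔ x ∈ U ∨ x - v j ∈ U := by
      intro x
      rw [Submodule.mem_sup]
      constructor
      · rintro ⟨y, hy, s, hs, rfl⟩
        obtain ⟨c, rfl⟩ := Submodule.mem_span_singleton.mp hs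
        rcases eq_or_ne c 0 with rfl | hc
        · left; simpa using hy
        · right
          obtain rfl : c = (1 : ZMod 2) := Fin.eq_one_of_ne_zero c hc
          rw [one_smul, add_sub_cancel_right]
          exact hy
      · rintro (hx | hx)
        · exact ⟨x, hx, 0, Submodule.zero_mem _, add_zero x⟩
        · exact ⟨x - v j, hx, v j, Submodule.mem_span_singleton_self _, sub_add_cancel _ _⟩
    obtain ⟨z', hz'⟩ : ∃ z' : ι → ZMod 2, ∀ l ∈ insert j J, v l ⬝ᵥ z' = b l := by
      obtain ⟨u, hu, huj⟩ := exists_dotProduct_eq_one_of_notMem hjU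
      refine ⟨z + (b j - v j ⬝ᵥ z) • u, fun l hl => ?_⟩
      rw [dotProduct_add, dotProduct_smul]
      rcases mem_insert.mp hl with rfl | hl
      · simp [huj]
      · simp [hu _ ((hUJ l).2 hl), hz l hl]
    obtain ⟨I', hI't, hII', hI'⟩ : ∃ I' : Finset ι, #I' ≤ t + 1 ∧ I ⊆ I' ∧
        ∀ u, u - v j ∈ U → (∀ i ∈ I', u i = 0) → u = 0 := by
      by_cases h : ∃ u, u - v j ∈ U ∧ ∀ i ∈ I, u i = 0
      · obtain ⟨u, huU, hu⟩ := h
        have hu0 : u ≠ 0 := by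
          rintro rfl
          exact hjU (by simpa using huU)
        obtain ⟨i, hi⟩ := Function.ne_iff.mp hu0
        refine ⟨insert i I, (card_insert_le _ _).trans (by omega), subset_insert _ _, ?_⟩
        intro x hxU hx
        have hxu : x - u = 0 := by
          refine hI _ (by simpa using U.sub_mem hxU huU) fun l hl => ?_
          simp [hu l hl, hx l (mem_insert_of_mem hl)]
        rw [sub_eq_zero.mp hxu] at hx
        exact absurd (hx i (mem_insert_self _ _)) hi
      · exact ⟨I, by omega, subset_rfl, fun u huU hu => absurd ⟨u, huU, hu⟩ h⟩
    refine ⟨U ⊔ Submodule.span (ZMod 2) {v j}, insert j J, z', I', ?_, fun l => ?_, hz', hI't,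
      fun u hu hu0 => ?_⟩
    · rw [card_insert_of_notMem hjJ, hJ]
    · rw [hmem, mem_insert, hUJ, or_comm]
      refine or_congr_left ⟨hj l, ?_⟩
      rintro rfl
      simp
    · rcases (hmem u).mp hu with hu | hu
      · exact hI u hu fun i hi => hu0 i (hII' hi)
      · exact hI' u hu hu0

open Finset in
/-- Averaging over the common solutions of the equations indexed by `J`: the equations outside `J`
contribute nothing on average, so some assignment has excess at least the weight of `J`. -/
lemma exists_excess_ge_of_subspace {ι κ : Type*} [Fintype ι] [Fintype κ]
    {v : κ → ι → ZMod 2} {b : κ → ZMod 2} (w : κ → ℤ)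
    {U : Submodule (ZMod 2) (ι → ZMod 2)} {J : Finset κ} {z₀ : ι → ZMod 2}
    (hUJ : ∀ j, v j ∈ U ↔ j ∈ J) (hz₀ : ∀ j ∈ J, v j ⬝ᵥ z₀ = b j) :
    ∃ z : ι → ZMod 2,
      ∑ j ∈ J, w j ≤ ∑ j, if v j ⬝ᵥ z = b j then w j else -w j := by
  classical
  set Z : Finset (ι → ZMod 2) := {z | ∀ j ∈ J, v j ⬝ᵥ z = b j} with hZ
  have hin : ∀ j ∈ J, ∑ z ∈ Z, (if v j ⬝ᵥ z = b j then w j else -w j) = ∑ z ∈ Z, w j :=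
    fun j hj => sum_congr rfl fun z hz => if_pos ((mem_filter.mp hz).2 j hj)
  have hout : ∀ j ∉ J, ∑ z ∈ Z, (if v j ⬝ᵥ z = b j then w j else -w j) = 0 := by
    intro j hj
    obtain ⟨u, hu, huj⟩ := exists_dotProduct_eq_one_of_notMem (mt (hUJ j).1 hj)
    have flip : ∀ x y : ZMod 2, x + 1 = y ↔ ¬ x = y := by decide
    refine sum_involution (fun z _ => z + u) ?_ ?_ ?_ ?_
    · intro z _
      simp only [dotProduct_add, huj, flip]
      split_ifs <;> simp
    · intro z _ _ h
      have : u = 0 := by simpa using h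
      simp [this] at huj
    · intro z hz
      simp only [hZ, mem_filter, mem_univ, true_and] at hz ⊢
      intro l hl
      rw [dotProduct_add, hu _ ((hUJ l).2 hl), hz l hl, add_zero]
    · intro z _
      ext i
      simp [add_assoc, CharTwo.add_self_eq_zero]
  have hsum : ∑ _z ∈ Z, ∑ j ∈ J, w j ≤
      ∑ z ∈ Z, ∑ j, if v j ⬝ᵥ z = b j then w j else -w j := by
    rw [sum_comm, sum_comm (s := Z) (t := univ), ← sum_subset (subset_univ J)
      fun j _ hj => hout j hj]
    exact (sum_congr rfl hin).ge
  obtain ⟨z, -, hz⟩ := exists_le_of_sum_le ⟨z₀, by simpa [hZ] using hz₀⟩ hsum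
  exact ⟨z, hz⟩

/-- Combinatorial core of Theorem 2: if the supports `α j` are
pairwise distinct nonempty subsets of `{1,…,n}`, every variable occurs in some
equation, the coefficient matrix has rank `n` (only `z = 0` makes all left-hand
sides vanish), `ρ` is the maximum number of equations containing any one
variable, `k ≥ 1` and `m > 2ρ(k-1)`, then there is `z` with `2·sat(z) ≥ W + k`. -/
theorem maxlin2_theorem2_core
    (n m : ℕ) (α : Fin m → Finset (Fin n)) (b : Fin m → ZMod 2)
    (w : Fin m → ℕ) (hw : ∀ j, 0 < w j)
    (hne : ∀ j, (α j).Nonempty)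
    (hdist : Function.Injective α)
    (hcover : ∀ i : Fin n, ∃ j, i ∈ α j)
    (hrank : ∀ z : Fin n → ZMod 2, (∀ j, ∑ i ∈ α j, z i = 0) → z = 0)
    (ρ : ℕ)
    (hρ : ρ = Finset.univ.sup
      (fun i : Fin n => (Finset.univ.filter (fun j => i ∈ α j)).card))
    (k : ℕ) (hk : 1 ≤ k) (hm : 2 * ρ * (k - 1) < m) :
    ∃ z : Fin n → ZMod 2,
      (∑ j, w j) + k ≤
        2 * ∑ j ∈ Finset.univ.filter (fun j => ∑ i ∈ α j, z i = b j), w j := by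
  set v : Fin m → Fin n → ZMod 2 := fun j i => if i ∈ α j then 1 else 0 with hvdef
  have hvne : ∀ j i, v j i ≠ 0 ↔ i ∈ α j := fun j i => by simp [hvdef]
  have hdot : ∀ j z, v j ⬝ᵥ z = ∑ i ∈ α j, z i := fun j z => by simp [hvdef, dotProduct]
  have hv : Function.Injective v := fun j l h => hdist <| by
    ext i
    rw [← hvne, ← hvne, h]
  have hv0 : ∀ j, v j ≠ 0 := fun j h => by
    obtain ⟨i, hi⟩ := hne j
    exact (hvne j i).2 hi (congrFun h i)
  obtain ⟨U, J, z₀, hJ, hUJ, hz₀⟩ := exists_subspace_inter_eq hv hv0 b ρ k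
    (fun i => by
      simp only [hvne, hρ]
      exact Finset.le_sup (f := fun i : Fin n =>
        (Finset.univ.filter (fun j => i ∈ α j)).card) (Finset.mem_univ i))
    (by simpa using hm)
  obtain ⟨z, hz⟩ := exists_excess_ge_of_subspace (fun j => (w j : ℤ)) hUJ hz₀
  refine ⟨z, ?_⟩
  have hkJ : (k : ℤ) ≤ ∑ j ∈ J, (w j : ℤ) := by
    have := Finset.card_nsmul_le_sum J w 1 fun j _ => hw j
    rw [hJ, smul_eq_mul, mul_one] at this
    exact_mod_cast this
  have hexcess : ∑ j, (if v j ⬝ᵥ z = b j then (w j : ℤ) else -w j) + ∑ j, (w j : ℤ) =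
      2 * ∑ j ∈ Finset.univ.filter (fun j => ∑ i ∈ α j, z i = b j), (w j : ℤ) := by
    rw [← Finset.sum_add_distrib, Finset.sum_filter, Finset.mul_sum]
    refine Finset.sum_congr rfl fun j _ => ?_
    rw [hdot]
    split_ifs <;> ring
  have : (∑ j, (w j : ℤ)) + k ≤
      2 * ∑ j ∈ Finset.univ.filter (fun j => ∑ i ∈ α j, z i = b j), (w j : ℤ) := by
    linarith
  exact_mod_cast this
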